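/- Suppose the full-space MFN problem is feasible. Then the set {α ∈ ℝⁿ : (α, H) is a minimizer of the full-space MFN problem for some symmetric H} equals {Q α̂ + v : (α̂, Ĥ) is a minimizer of the subspace MFN problem for some symmetric Ĥ, and v ∈ col(Q)⊥}. -/

import Mathlib

open Matrix

/-- Squared Frobenius norm of a real matrix. -/
noncomputable def frobSq {a b : ℕ} (A : Matrix (Fin a) (Fin b) ℝ) : ℝ :=
  ∑ i, ∑ j, (A i j) ^ 2

/-- Squared Euclidean norm of a real vector. -/
noncomputable def vecNormSq {a : ℕ} (v : Fin a → ℝ) : ℝ :=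
  ∑ i, (v i) ^ 2

/-- `v` lies in the orthogonal complement of the column space of `Q`. -/
def inColPerp {n d : ℕ} (Q : Matrix (Fin n) (Fin d) ℝ) (v : Fin n → ℝ) : Prop :=
  ∀ u : Fin d → ℝ, Q.mulVec u ⬝ᵥ v = 0

/-- Feasibility for the quadratic interpolation constraints: `p = (α, H)` with `H`
symmetric and `(dᵢ)ᵀ α + ½ (dᵢ)ᵀ H dᵢ = rhs i` for all `i`. -/
def QFeas {k m : ℕ} (dd : Fin m → Fin k → ℝ) (rhs : Fin m → ℝ)
    (p : (Fin k → ℝ) × Matrix (Fin k) (Fin k) ℝ) : Prop :=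
  p.2.IsSymm ∧ ∀ i, dd i ⬝ᵥ p.1 + (1 / 2) * (dd i ⬝ᵥ p.2.mulVec (dd i)) = rhs i

/-- Objective of the minimum norm (MN) problem. -/
noncomputable def MNObj {k : ℕ} (p : (Fin k → ℝ) × Matrix (Fin k) (Fin k) ℝ) : ℝ :=
  (1 / 2) * vecNormSq p.1 + (1 / 2) * frobSq p.2

/-- `p` is a minimizer of the MN problem. -/
def MNMin {k m : ℕ} (dd : Fin m → Fin k → ℝ) (rhs : Fin m → ℝ)
    (p : (Fin k → ℝ) × Matrix (Fin k) (Fin k) ℝ) : Prop :=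
  QFeas dd rhs p ∧ ∀ q, QFeas dd rhs q → MNObj p ≤ MNObj q

/-- Objective of the minimum Frobenius norm (MFN) problem. -/
noncomputable def MFNObj {k : ℕ} (p : (Fin k → ℝ) × Matrix (Fin k) (Fin k) ℝ) : ℝ :=
  (1 / 2) * frobSq p.2

/-- `p` is a minimizer of the MFN problem. -/
def MFNMin {k m : ℕ} (dd : Fin m → Fin k → ℝ) (rhs : Fin m → ℝ)
    (p : (Fin k → ℝ) × Matrix (Fin k) (Fin k) ℝ) : Prop :=
  QFeas dd rhs p ∧ ∀ q, QFeas dd rhs q → MFNObj p ≤ MFNObj q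

/-- Objective of the least Frobenius norm updating (LFU) problem. -/
noncomputable def LFUObj {k : ℕ} (Hbar : Matrix (Fin k) (Fin k) ℝ)
    (p : (Fin k → ℝ) × Matrix (Fin k) (Fin k) ℝ) : ℝ :=
  (1 / 2) * frobSq (p.2 - Hbar)

/-- `p` is a minimizer of the LFU problem with reference matrix `Hbar`. -/
def LFUMin {k m : ℕ} (dd : Fin m → Fin k → ℝ) (rhs : Fin m → ℝ)
    (Hbar : Matrix (Fin k) (Fin k) ℝ)
    (p : (Fin k → ℝ) × Matrix (Fin k) (Fin k) ℝ) : Prop :=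
  QFeas dd rhs p ∧ ∀ q, QFeas dd rhs q → LFUObj Hbar p ≤ LFUObj Hbar q

/-- `X` is a Moore–Penrose pseudoinverse of `A`. -/
def IsMPInv {a b : ℕ} (A : Matrix (Fin a) (Fin b) ℝ) (X : Matrix (Fin b) (Fin a) ℝ) : Prop :=
  A * X * A = A ∧ X * A * X = X ∧ (A * X)ᵀ = A * X ∧ (X * A)ᵀ = X * A

/-- The vector `δ_g(y⁰; W)` with `i`-th entry `g(y⁰ + wⁱ) − g(y⁰)`,
where `wⁱ` is the `i`-th column of `W`. -/
noncomputable def deltaVec {k p : ℕ} (g : (Fin k → ℝ) → ℝ) (y0 : Fin k → ℝ)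
    (W : Matrix (Fin k) (Fin p) ℝ) : Fin p → ℝ :=
  fun i => g (y0 + fun j => W j i) - g y0

theorem frobSq_eq_trace {a b : ℕ} (A : Matrix (Fin a) (Fin b) ℝ) :
    frobSq A = (Aᵀ * A).trace := by
  simp only [frobSq, Matrix.trace, Matrix.diag, Matrix.mul_apply, Matrix.transpose_apply, pow_two]
  exact Finset.sum_comm

theorem frobSq_nonneg {a b : ℕ} (A : Matrix (Fin a) (Fin b) ℝ) : 0 ≤ frobSq A :=
  Finset.sum_nonneg fun _ _ => Finset.sum_nonneg fun _ _ => sq_nonneg _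

theorem frobSq_transpose {a b : ℕ} (A : Matrix (Fin a) (Fin b) ℝ) : frobSq Aᵀ = frobSq A :=
  Finset.sum_comm

/-- Left multiplication by a matrix with orthonormal columns preserves the Frobenius norm. -/
theorem frobSq_mul_left {n d b : ℕ} {Q : Matrix (Fin n) (Fin d) ℝ} (hQ : Qᵀ * Q = 1)
    (B : Matrix (Fin d) (Fin b) ℝ) : frobSq (Q * B) = frobSq B := by
  rw [frobSq_eq_trace, frobSq_eq_trace, transpose_mul, Matrix.mul_assoc, ← Matrix.mul_assoc Qᵀ,
    hQ, Matrix.one_mul]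

/-- Left multiplication by the transpose of a matrix with orthonormal columns does not increase
the Frobenius norm. -/
theorem frobSq_transpose_mul_le {n d b : ℕ} {Q : Matrix (Fin n) (Fin d) ℝ} (hQ : Qᵀ * Q = 1)
    (A : Matrix (Fin n) (Fin b) ℝ) : frobSq (Qᵀ * A) ≤ frobSq A := by
  have hres : (A - Q * (Qᵀ * A))ᵀ * (A - Q * (Qᵀ * A)) = Aᵀ * A - (Qᵀ * A)ᵀ * (Qᵀ * A) := by
    have hQA : Qᵀ * (Q * (Qᵀ * A)) = Qᵀ * A := by
      rw [← Matrix.mul_assoc, hQ, Matrix.one_mul]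
    simp only [transpose_sub, transpose_mul, transpose_transpose, Matrix.sub_mul, Matrix.mul_sub,
      Matrix.mul_assoc, hQA]
    abel
  have h := frobSq_nonneg (A - Q * (Qᵀ * A))
  rw [frobSq_eq_trace, hres, trace_sub, ← frobSq_eq_trace, ← frobSq_eq_trace] at h
  linarith

theorem frobSq_conj {n d : ℕ} {Q : Matrix (Fin n) (Fin d) ℝ} (hQ : Qᵀ * Q = 1)
    (B : Matrix (Fin d) (Fin d) ℝ) : frobSq (Q * B * Qᵀ) = frobSq B := by
  rw [Matrix.mul_assoc, frobSq_mul_left hQ, ← frobSq_transpose, transpose_mul,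
    transpose_transpose, frobSq_mul_left hQ, frobSq_transpose]

theorem frobSq_compress_le {n d : ℕ} {Q : Matrix (Fin n) (Fin d) ℝ} (hQ : Qᵀ * Q = 1)
    (A : Matrix (Fin n) (Fin n) ℝ) : frobSq (Qᵀ * A * Q) ≤ frobSq A := by
  calc frobSq (Qᵀ * A * Q) ≤ frobSq (A * Q) := by
        rw [Matrix.mul_assoc]; exact frobSq_transpose_mul_le hQ _
    _ = frobSq (Qᵀ * Aᵀ) := by rw [← frobSq_transpose, transpose_mul]
    _ ≤ frobSq A := (frobSq_transpose_mul_le hQ _).trans_eq (frobSq_transpose A)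

theorem mulVec_dotProduct_eq {n d : ℕ} (Q : Matrix (Fin n) (Fin d) ℝ) (u : Fin d → ℝ)
    (w : Fin n → ℝ) : Q *ᵥ u ⬝ᵥ w = u ⬝ᵥ Qᵀ *ᵥ w := by
  rw [dotProduct_mulVec, vecMul_transpose]

/-- Feasible points of the full-space problem restrict to feasible points of the subspace
problem. -/
theorem QFeas.compress {n d m : ℕ} {Q : Matrix (Fin n) (Fin d) ℝ} {dh : Fin m → Fin d → ℝ}
    {rhs : Fin m → ℝ} {α : Fin n → ℝ} {H : Matrix (Fin n) (Fin n) ℝ}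
    (h : QFeas (fun i => Q *ᵥ dh i) rhs (α, H)) :
    QFeas dh rhs (Qᵀ *ᵥ α, Qᵀ * H * Q) := by
  obtain ⟨hs, hc⟩ := h
  refine ⟨?_, fun i => ?_⟩
  · have hs' : Hᵀ = H := hs
    simp [Matrix.IsSymm, transpose_mul, hs', Matrix.mul_assoc]
  · have := hc i
    simp only [mulVec_dotProduct_eq] at this
    simpa only [← mulVec_mulVec] using this

/-- Feasible points of the subspace problem lift to feasible points of the full-space problem. -/
theorem QFeas.lift {n d m : ℕ} {Q : Matrix (Fin n) (Fin d) ℝ} (hQ : Qᵀ * Q = 1)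
    {dh : Fin m → Fin d → ℝ} {rhs : Fin m → ℝ} {αh : Fin d → ℝ}
    {Hh : Matrix (Fin d) (Fin d) ℝ} (h : QFeas dh rhs (αh, Hh))
    {v : Fin n → ℝ} (hv : inColPerp Q v) :
    QFeas (fun i => Q *ᵥ dh i) rhs (Q *ᵥ αh + v, Q * Hh * Qᵀ) := by
  obtain ⟨hs, hc⟩ := h
  have hcancel (u : Fin d → ℝ) : Qᵀ *ᵥ (Q *ᵥ u) = u := by
    rw [mulVec_mulVec, hQ, one_mulVec]
  refine ⟨?_, fun i => ?_⟩
  · have hs' : Hhᵀ = Hh := hs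
    simp [Matrix.IsSymm, transpose_mul, hs', Matrix.mul_assoc]
  · simp only [dotProduct_add, hv (dh i), add_zero, mulVec_dotProduct_eq, ← mulVec_mulVec, hcancel]
    exact hc i

/-- If the full-space MFN problem is feasible, then the set of gradient
components of minimizers of the full-space MFN problem equals
`{Q α̂ + v : (α̂, Ĥ) a subspace MFN minimizer, v ∈ col(Q)⊥}`. -/
theorem stmt_5 {n d m : ℕ} (hn : 0 < n) (hd : 0 < d) (hm : 0 < m) (hdn : d < n)
    (Q : Matrix (Fin n) (Fin d) ℝ) (hQ : Qᵀ * Q = 1)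
    (f : (Fin n → ℝ) → ℝ) (x0 : Fin n → ℝ) (dh : Fin m → Fin d → ℝ)
    (fh : (Fin d → ℝ) → ℝ) (hfh : ∀ xh, fh xh = f (x0 + Q.mulVec xh))
    (hfeas : ∃ p, QFeas (fun i => Q.mulVec (dh i))
      (fun i => f (x0 + Q.mulVec (dh i)) - f x0) p) :
    {α : Fin n → ℝ | ∃ H, MFNMin (fun i => Q.mulVec (dh i))
        (fun i => f (x0 + Q.mulVec (dh i)) - f x0) (α, H)} =
    {α : Fin n → ℝ | ∃ (αh : Fin d → ℝ) (Hh : Matrix (Fin d) (Fin d) ℝ) (v : Fin n → ℝ),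
        MFNMin dh (fun i => fh (dh i) - fh 0) (αh, Hh) ∧ inColPerp Q v ∧
        α = Q.mulVec αh + v} := by
  have hrhs : (fun i => fh (dh i) - fh 0) = fun i => f (x0 + Q.mulVec (dh i)) - f x0 := by
    funext i
    rw [hfh, hfh, mulVec_zero, add_zero]
  rw [hrhs]
  ext α
  constructor
  · rintro ⟨H, hH, hmin⟩
    refine ⟨Qᵀ *ᵥ α, Qᵀ * H * Q, α - Q *ᵥ (Qᵀ *ᵥ α), ⟨hH.compress, ?_⟩, fun u => ?_, by simp⟩
    · rintro ⟨β, B⟩ hB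
      have hle := hmin _ (hB.lift hQ (v := 0) fun u => dotProduct_zero _)
      have hcomp := frobSq_compress_le hQ H
      simp only [MFNObj, frobSq_conj hQ] at hle ⊢
      linarith
    · rw [mulVec_dotProduct_eq, mulVec_sub, mulVec_mulVec, hQ, one_mulVec, sub_self,
        dotProduct_zero]
  · rintro ⟨αh, Hh, v, ⟨hH, hmin⟩, hv, rfl⟩
    refine ⟨Q * Hh * Qᵀ, hH.lift hQ hv, ?_⟩
    rintro ⟨β, B⟩ hB
    have hle := hmin _ hB.compress
    have hcomp := frobSq_compress_le hQ B
    simp only [MFNObj, frobSq_conj hQ] at hle ⊢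
    linarith
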